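/- arXiv:2212.03566 — 3 statements merged into one kernel-verified Lean document; each statement's English description precedes it below -/
import Mathlib

section
/- For every θ > 0 and ω ∈ ℝ, lim_{T→∞} (1/T)·∫₀^T ∫₀^t exp(−iω(s−t))·exp(−θ(t−s)) ds dt = 1/(θ − iω); consequently lim_{T→∞} (1/(2θT))·(f₂(T,ω,θ) + conj(f₂(T,ω,θ))) = 1/(θ² + ω²), where f₂(T,ω,θ) := ∫₀^T ∫₀^t exp(−iω(s−t))·exp(−θ(t−s)) ds dt and conj denotes complex conjugation. -/
open MeasureTheory Filter ComplexConjugate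

/-- With `f₂(T,ω,θ) = ∫₀ᵀ ∫₀ᵗ exp(−iω(s−t)) exp(−θ(t−s)) ds dt`,
one has `lim_{T→∞} f₂(T,ω,θ)/T = 1/(θ − iω)` and consequently
`lim_{T→∞} (f₂ + conj f₂)/(2θT) = 1/(θ² + ω²)`. -/
theorem stmt_7 (θ : ℝ) (hθ : 0 < θ) (ω : ℝ)
    (f₂ : ℝ → ℂ)
    (hf₂ : ∀ T : ℝ, f₂ T = ∫ t in (0 : ℝ)..T, ∫ s in (0 : ℝ)..t,
      Complex.exp (-(Complex.I * ω * (s - t))) * ((Real.exp (-θ * (t - s)) : ℝ) : ℂ)) :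
    Tendsto (fun T : ℝ => (1 / (T : ℂ)) * f₂ T) atTop
      (nhds (1 / ((θ : ℂ) - Complex.I * ω))) ∧
    Tendsto (fun T : ℝ => (1 / (2 * (θ : ℂ) * T)) * (f₂ T + conj (f₂ T))) atTop
      (nhds ((1 / (θ ^ 2 + ω ^ 2) : ℝ) : ℂ)) := by
  have hθ' : (θ : ℂ) ≠ 0 := by exact_mod_cast hθ.ne'
  obtain ⟨c, hc⟩ : ∃ c : ℂ, c = (θ : ℂ) - Complex.I * ω := ⟨_, rfl⟩
  have hre : c.re = θ := by simp [hc]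
  have hc0 : c ≠ 0 := by
    intro h
    rw [h] at hre
    simp at hre
    exact hθ.ne hre
  have hcc : conj c = (θ : ℂ) + Complex.I * ω := by simp [hc]
  have hcc0 : conj c ≠ 0 := by simpa using hc0
  have hinner : ∀ t : ℝ, (∫ s in (0 : ℝ)..t,
      Complex.exp (-(Complex.I * ω * (s - t))) * ((Real.exp (-θ * (t - s)) : ℝ) : ℂ))
      = 1 / c - (1 / c) * Complex.exp (-c * t) := by
    intro t
    have h1 : ∀ s : ℝ, Complex.exp (-(Complex.I * ω * (s - t))) *
        ((Real.exp (-θ * (t - s)) : ℝ) : ℂ)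
        = Complex.exp (-c * t) * Complex.exp (c * s) := by
      intro s
      rw [Complex.ofReal_exp, ← Complex.exp_add, ← Complex.exp_add, hc]
      congr 1
      push_cast
      ring
    simp_rw [h1]
    rw [intervalIntegral.integral_const_mul, integral_exp_mul_complex hc0]
    have h2 : Complex.exp (-c * t) * Complex.exp (c * t) = 1 := by
      rw [← Complex.exp_add]; simp
    simp only [Complex.ofReal_zero, mul_zero, Complex.exp_zero]
    field_simp
    rw [neg_mul] at h2
    linear_combination h2
  have hf : ∀ T : ℝ, f₂ T = T / c + (Complex.exp (-c * T) - 1) / c ^ 2 := by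
    intro T
    rw [hf₂]
    simp_rw [hinner]
    rw [intervalIntegral.integral_sub (by simp)
      (Continuous.intervalIntegrable (by fun_prop) _ _),
      intervalIntegral.integral_const_mul, integral_exp_mul_complex (neg_ne_zero.mpr hc0)]
    simp
    field_simp
    ring
  have hinv : Tendsto (fun T : ℝ => (1 / (T : ℂ))) atTop (nhds 0) := by
    have := (Complex.continuous_ofReal.tendsto 0).comp tendsto_inv_atTop_zero
    simpa [Function.comp_def] using this
  have hexp : Tendsto (fun T : ℝ => Complex.exp (-c * T)) atTop (nhds 0) := by
    rw [tendsto_zero_iff_norm_tendsto_zero]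
    simp only [Complex.norm_exp]
    refine Real.tendsto_exp_atBot.comp ?_
    have : ∀ T : ℝ, (-c * (T : ℂ)).re = -(θ * T) := by intro T; simp [hre]
    simp only [this]
    exact tendsto_neg_atTop_atBot.comp (tendsto_id.const_mul_atTop hθ)
  have key : Tendsto (fun T : ℝ => (1 / (T : ℂ)) * f₂ T) atTop (nhds (1 / c)) := by
    have h := (hinv.mul ((hexp.sub_const 1).div_const (c ^ 2))).const_add (1 / c)
    rw [zero_mul, add_zero] at h
    refine h.congr' ?_
    filter_upwards [eventually_gt_atTop 0] with T hT
    have hT' : (T : ℂ) ≠ 0 := by exact_mod_cast hT.ne'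
    rw [hf]
    field_simp
  refine ⟨hc ▸ key, ?_⟩
  have hk := (key.add ((Complex.continuous_conj.tendsto _).comp key)).const_mul (1 / (2 * (θ : ℂ)))
  have hlim : 1 / (2 * (θ : ℂ)) * (1 / c + conj (1 / c)) = ((1 / (θ ^ 2 + ω ^ 2) : ℝ) : ℂ) := by
    have hp : c * conj c = (θ : ℂ) ^ 2 + ω ^ 2 := by
      rw [hcc, hc]
      linear_combination (-(ω : ℂ) ^ 2) * Complex.I_sq
    have hs : c + conj c = 2 * θ := by rw [hcc, hc]; ring
    push_cast
    rw [← hp, map_div₀, map_one, ← hs]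
    have : c + conj c ≠ 0 := by rw [hs]; simpa using hθ'
    field_simp
    ring
  rw [hlim] at hk
  refine hk.congr fun T => ?_
  simp only [Function.comp, map_mul, map_div₀, map_one, Complex.conj_ofReal]
  rw [← mul_add, ← mul_assoc, ← one_div_mul_one_div (2 * (θ : ℂ)) (T : ℂ)]
end

section
/- Let θ > 0, γ ∈ ℝ and ω ∈ ℝ. Define I₁(T) := ∫₀^T ∫₀^T exp(−iω(t−s))·(1/(2θ))·exp(−θ|t−s|) dt ds and I₂(T) := ∫₀^T ∫₀^t exp(−iω(s−t))·exp(−θ(t−s)) ds dt. Then lim_{T→∞} (1/T)·(γ²·I₁(T) + 2γ·Re(I₂(T)) + T) = ((γ + θ)² + ω²) / (θ² + ω²). In particular, for γ = −θ the limit equals ω²/(θ² + ω²), which tends to 0 as ω → 0 and is monotonically increasing in |ω|. -/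
open MeasureTheory Filter

/-- Closed form of the iterated exponential integral. -/
noncomputable def expG (c : ℂ) (T : ℝ) : ℂ := T / c - (1 - Complex.exp (-c * T)) / c ^ 2

theorem int_exp0 (c : ℂ) (hc : c ≠ 0) (t : ℝ) :
    ∫ u in (0 : ℝ)..t, Complex.exp (-c * u) = (1 - Complex.exp (-c * t)) / c := by
  rw [integral_exp_mul_complex (neg_ne_zero.mpr hc)]
  simp only [Complex.ofReal_zero, mul_zero, Complex.exp_zero]
  field_simp
  ring

theorem int_exp1 (c : ℂ) (hc : c ≠ 0) (t : ℝ) :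
    ∫ s in (0 : ℝ)..t, Complex.exp (-c * ((t - s : ℝ) : ℂ)) = (1 - Complex.exp (-c * t)) / c := by
  rw [intervalIntegral.integral_comp_sub_left (fun u : ℝ => Complex.exp (-c * (u : ℂ))) t]
  simpa using int_exp0 c hc t

theorem int_exp2 (c : ℂ) (hc : c ≠ 0) (s T : ℝ) :
    ∫ t in s..T, Complex.exp (-c * ((t - s : ℝ) : ℂ))
      = (1 - Complex.exp (-c * ((T - s : ℝ) : ℂ))) / c := by
  rw [intervalIntegral.integral_comp_sub_right (fun u : ℝ => Complex.exp (-c * (u : ℂ))) s]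
  simpa using int_exp0 c hc (T - s)

theorem int_G (c : ℂ) (hc : c ≠ 0) (T : ℝ) :
    ∫ t in (0 : ℝ)..T, (1 - Complex.exp (-c * t)) / c = expG c T := by
  rw [intervalIntegral.integral_div, intervalIntegral.integral_sub, int_exp0 c hc]
  · simp [expG]
    field_simp
  · exact intervalIntegrable_const
  · exact Continuous.intervalIntegrable (by fun_prop) _ _

theorem int_G' (c : ℂ) (hc : c ≠ 0) (T : ℝ) :
    ∫ s in (0 : ℝ)..T, (1 - Complex.exp (-c * ((T - s : ℝ) : ℂ))) / c = expG c T := by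
  rw [intervalIntegral.integral_comp_sub_left
    (fun u : ℝ => (1 - Complex.exp (-c * (u : ℂ))) / c) T]
  simpa using int_G c hc T

theorem tendsto_G (c : ℂ) (hc : 0 < c.re) :
    Tendsto (fun T : ℝ => expG c T / T) atTop (nhds (1 / c)) := by
  have hc0 : c ≠ 0 := by rintro rfl; simp at hc
  have h0 : Tendsto (fun T : ℝ => (1 - Complex.exp (-c * T)) / c ^ 2 / T) atTop (nhds 0) := by
    have hb : Tendsto (fun T : ℝ => (2 / ‖c ^ 2‖) * T⁻¹) atTop (nhds 0) := by
      have h := (tendsto_inv_atTop_zero (𝕜 := ℝ)).const_mul (2 / ‖c ^ 2‖)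
      rwa [mul_zero] at h
    refine squeeze_zero_norm' ?_ hb
    filter_upwards [eventually_gt_atTop 0] with T hT
    have h1 : ‖1 - Complex.exp (-c * T)‖ ≤ 2 := by
      refine (norm_sub_le _ _).trans ?_
      have : ‖Complex.exp (-c * T)‖ ≤ 1 := by
        rw [Complex.norm_exp]
        simp
        positivity
      simp only [norm_one]; linarith
    rw [norm_div, norm_div, Complex.norm_real, Real.norm_eq_abs, abs_of_pos hT, div_eq_mul_inv _ T]
    gcongr
  have h2 : Tendsto (fun T : ℝ => 1 / c - (1 - Complex.exp (-c * T)) / c ^ 2 / T) atTop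
      (nhds (1 / c)) := by simpa using tendsto_const_nhds.sub h0
  refine h2.congr' ?_
  filter_upwards [eventually_gt_atTop 0] with T hT
  have : (T : ℂ) ≠ 0 := by exact_mod_cast hT.ne'
  unfold expG
  field_simp


/-- The power spectral density of `dY_t = γ U_t dt + dW_t`:
`lim_{T→∞} (1/T)(γ² I₁(T) + 2γ Re I₂(T) + T) = ((γ+θ)² + ω²)/(θ² + ω²)`;
in particular for `γ = −θ` the limit is `ω²/(θ² + ω²)`, which tends to `0` as
`ω → 0` and is monotonically increasing in `|ω|`. -/
theorem stmt_8 (θ : ℝ) (hθ : 0 < θ) (γ : ℝ) (ω : ℝ)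
    (I₁ I₂ : ℝ → ℂ)
    (hI₁ : ∀ T : ℝ, I₁ T = ∫ s in (0 : ℝ)..T, ∫ t in (0 : ℝ)..T,
      Complex.exp (-(Complex.I * ω * (t - s))) *
        ((1 / (2 * θ) * Real.exp (-θ * |t - s|) : ℝ) : ℂ))
    (hI₂ : ∀ T : ℝ, I₂ T = ∫ t in (0 : ℝ)..T, ∫ s in (0 : ℝ)..t,
      Complex.exp (-(Complex.I * ω * (s - t))) * ((Real.exp (-θ * (t - s)) : ℝ) : ℂ)) :
    Tendsto
      (fun T : ℝ => (1 / (T : ℂ)) *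
        ((γ : ℂ) ^ 2 * I₁ T + 2 * (γ : ℂ) * (((I₂ T).re : ℝ) : ℂ) + (T : ℂ)))
      atTop (nhds ((((γ + θ) ^ 2 + ω ^ 2) / (θ ^ 2 + ω ^ 2) : ℝ) : ℂ)) ∧
    (γ = -θ → ((γ + θ) ^ 2 + ω ^ 2) / (θ ^ 2 + ω ^ 2) = ω ^ 2 / (θ ^ 2 + ω ^ 2)) ∧
    Tendsto (fun w : ℝ => w ^ 2 / (θ ^ 2 + w ^ 2)) (nhds 0) (nhds 0) ∧
    (∀ w₁ w₂ : ℝ, |w₁| ≤ |w₂| →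
      w₁ ^ 2 / (θ ^ 2 + w₁ ^ 2) ≤ w₂ ^ 2 / (θ ^ 2 + w₂ ^ 2)) := by
  set a : ℂ := θ + Complex.I * ω with ha
  set b : ℂ := θ - Complex.I * ω with hb
  have hare : 0 < a.re := by simpa [ha] using hθ
  have hbre : 0 < b.re := by simpa [hb] using hθ
  have ha0 : a ≠ 0 := by intro h; rw [h] at hare; simp at hare
  have hb0 : b ≠ 0 := by intro h; rw [h] at hbre; simp at hbre
  have e2 : ∀ T, I₂ T = expG b T := by
    intro T
    rw [hI₂, ← int_G b hb0]
    refine intervalIntegral.integral_congr fun t _ => ?_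
    try simp only
    rw [← int_exp1 b hb0]
    refine intervalIntegral.integral_congr fun s _ => ?_
    try simp only
    rw [Complex.ofReal_exp, ← Complex.exp_add]
    congr 1
    push_cast [hb]
    ring
  have e1 : ∀ T, 0 < T → I₁ T = 1 / (2 * θ) * (expG b T + expG a T) := by
    intro T hT
    rw [hI₁, ← int_G b hb0, ← int_G' a ha0, ← intervalIntegral.integral_add,
      ← intervalIntegral.integral_const_mul]
    rotate_left
    · exact Continuous.intervalIntegrable (by fun_prop) _ _
    · exact Continuous.intervalIntegrable (by fun_prop) _ _
    refine intervalIntegral.integral_congr fun s hs => ?_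
    rw [Set.uIcc_of_le hT.le] at hs
    try simp only
    rw [← int_exp1 b hb0, ← int_exp2 a ha0,
      ← intervalIntegral.integral_add_adjacent_intervals (b := s), mul_add,
      ← intervalIntegral.integral_const_mul, ← intervalIntegral.integral_const_mul]
    rotate_left
    · exact Continuous.intervalIntegrable (by fun_prop) _ _
    · exact Continuous.intervalIntegrable (by fun_prop) _ _
    congr 1
    · refine intervalIntegral.integral_congr fun t ht => ?_
      rw [Set.uIcc_of_le hs.1] at ht
      try simp only
      rw [abs_of_nonpos (by linarith [ht.2]), Complex.ofReal_mul, Complex.ofReal_exp,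
        mul_left_comm, ← Complex.exp_add]
      push_cast [hb]
      ring_nf
    · refine intervalIntegral.integral_congr fun t ht => ?_
      rw [Set.uIcc_of_le hs.2] at ht
      try simp only
      rw [abs_of_nonneg (by linarith [ht.1]), Complex.ofReal_mul, Complex.ofReal_exp,
        mul_left_comm, ← Complex.exp_add]
      push_cast [ha]
      ring_nf
  have hD : (0 : ℝ) < θ ^ 2 + ω ^ 2 := by positivity
  have hab : a * b = ((θ ^ 2 + ω ^ 2 : ℝ) : ℂ) := by
    push_cast [ha, hb]
    linear_combination (-(ω : ℂ) ^ 2) * Complex.I_sq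
  refine ⟨?_, ?_, ?_, ?_⟩
  · have ta := tendsto_G a hare
    have tb := tendsto_G b hbre
    have tr : Tendsto (fun T : ℝ => (((expG b T / T).re : ℝ) : ℂ)) atTop
        (nhds (((1 / b).re : ℝ) : ℂ)) :=
      ((Complex.continuous_ofReal.comp Complex.continuous_re).tendsto _).comp tb
    have key := (((tb.add ta).const_mul ((γ : ℂ) ^ 2 * (1 / (2 * θ)))).add
      (tr.const_mul (2 * (γ : ℂ)))).add (tendsto_const_nhds (x := (1 : ℂ)))
    have hlim : (γ : ℂ) ^ 2 * (1 / (2 * θ)) * (1 / b + 1 / a) + 2 * (γ : ℂ) * (((1 / b).re : ℝ) : ℂ)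
        + 1 = ((((γ + θ) ^ 2 + ω ^ 2) / (θ ^ 2 + ω ^ 2) : ℝ) : ℂ) := by
      have hr : (1 / b).re = θ / (θ ^ 2 + ω ^ 2) := by
        simp [hb, Complex.normSq_apply, sq]
      have hs : 1 / b + 1 / a = ((2 * θ / (θ ^ 2 + ω ^ 2) : ℝ) : ℂ) := by
        rw [Complex.ofReal_div, ← hab]
        field_simp
        push_cast [ha, hb]
        ring
      rw [hr, hs]
      norm_cast
      field_simp
      ring
    rw [hlim] at key
    refine key.congr' ?_
    filter_upwards [eventually_gt_atTop 0] with T hT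
    have hT0 : (T : ℂ) ≠ 0 := by exact_mod_cast hT.ne'
    have hθ0 : (θ : ℂ) ≠ 0 := by exact_mod_cast hθ.ne'
    rw [e1 T hT, e2 T, Complex.div_ofReal_re, Complex.ofReal_div]
    field_simp
  · rintro rfl
    simp
  · have : ContinuousAt (fun w : ℝ => w ^ 2 / (θ ^ 2 + w ^ 2)) 0 := by
      refine ContinuousAt.div (by fun_prop) (by fun_prop) ?_
      positivity
    simpa [ContinuousAt] using this
  · intro w₁ w₂ h
    have h2 := sq_le_sq.mpr h
    rw [div_le_div_iff₀ (by positivity) (by positivity)]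
    nlinarith [mul_le_mul_of_nonneg_left h2 (sq_nonneg θ)]
end

section
/- Let λ > 0 and θ > 0 with λ ≠ θ, and for t, t′ ≥ 0 define C(t, t′) := ∫₀^t ∫₀^{t′} exp(−λ(t−s))·exp(−λ(t′−r))·(1/(2θ))·exp(−θ|s−r|) dr ds. Then for every τ ≥ 0, lim_{t→∞} C(t, t+τ) / C(t, t) = (λ·exp(−θτ) − θ·exp(−λτ)) / (λ − θ). The right-hand side is invariant under interchanging λ and θ. -/
open MeasureTheory Filter

lemma aux_int (c k a b : ℝ) (hk : k ≠ 0) :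
    ∫ x in a..b, Real.exp (c + k * x) = (Real.exp (c + k * b) - Real.exp (c + k * a)) / k := by
  have h : ∀ x ∈ Set.uIcc a b,
      HasDerivAt (fun x => Real.exp (c + k * x) / k) (Real.exp (c + k * x)) x := by
    intro x _
    have h1 : HasDerivAt (fun x : ℝ => c + k * x) k x := by
      simpa using ((hasDerivAt_id x).const_mul k).const_add c
    have h2 := h1.exp.div_const k
    rwa [mul_div_assoc, div_self hk, mul_one] at h2
  rw [intervalIntegral.integral_eq_sub_of_hasDerivAt h
    (Continuous.intervalIntegrable (by fun_prop) _ _)]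
  ring

lemma aux_inner (lam θ : ℝ) (hlam : 0 < lam) (hθ : 0 < θ) (hne : lam ≠ θ)
    (t t' s : ℝ) (h0 : 0 ≤ s) (h1 : s ≤ t') :
    (∫ r in (0 : ℝ)..t', Real.exp (-lam * (t - s)) * Real.exp (-lam * (t' - r))
        * (1 / (2 * θ) * Real.exp (-θ * |s - r|))) =
    (1 / (2 * θ)) * ((1 / (lam + θ) - 1 / (lam - θ)) * Real.exp (-lam * (t + t') + (2 * lam) * s)
      - 1 / (lam + θ) * Real.exp (-lam * (t + t') + (lam - θ) * s)
      + 1 / (lam - θ) * Real.exp (-lam * t - θ * t' + (lam + θ) * s)) := by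
  have hp : lam + θ ≠ 0 := by positivity
  have hm : lam - θ ≠ 0 := sub_ne_zero.mpr hne
  rw [← intervalIntegral.integral_add_adjacent_intervals (b := s)
    (Continuous.intervalIntegrable (by fun_prop) _ _)
    (Continuous.intervalIntegrable (by fun_prop) _ _)]
  have e1 : (∫ r in (0 : ℝ)..s, Real.exp (-lam * (t - s)) * Real.exp (-lam * (t' - r))
        * (1 / (2 * θ) * Real.exp (-θ * |s - r|))) =
      ∫ r in (0 : ℝ)..s, (1 / (2 * θ)) *
        Real.exp ((-lam * (t - s) - lam * t' - θ * s) + (lam + θ) * r) := by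
    apply intervalIntegral.integral_congr
    intro r hr
    rw [Set.uIcc_of_le h0] at hr
    simp only
    rw [abs_of_nonneg (by linarith [hr.2]), mul_left_comm, ← Real.exp_add, ← Real.exp_add]
    congr 2
    ring
  have e2 : (∫ r in s..t', Real.exp (-lam * (t - s)) * Real.exp (-lam * (t' - r))
        * (1 / (2 * θ) * Real.exp (-θ * |s - r|))) =
      ∫ r in s..t', (1 / (2 * θ)) *
        Real.exp ((-lam * (t - s) - lam * t' + θ * s) + (lam - θ) * r) := by
    apply intervalIntegral.integral_congr
    intro r hr
    rw [Set.uIcc_of_le h1] at hr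
    simp only
    rw [abs_of_nonpos (by linarith [hr.1]), mul_left_comm, ← Real.exp_add, ← Real.exp_add]
    congr 2
    ring
  rw [e1, e2, intervalIntegral.integral_const_mul, intervalIntegral.integral_const_mul,
    aux_int _ _ _ _ hp, aux_int _ _ _ _ hm]
  rw [show (-lam * (t - s) - lam * t' - θ * s) + (lam + θ) * s = -lam * (t + t') + (2 * lam) * s by ring,
    show (-lam * (t - s) - lam * t' - θ * s) + (lam + θ) * 0 = -lam * (t + t') + (lam - θ) * s by ring,
    show (-lam * (t - s) - lam * t' + θ * s) + (lam - θ) * t' = -lam * t - θ * t' + (lam + θ) * s by ring,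
    show (-lam * (t - s) - lam * t' + θ * s) + (lam - θ) * s = -lam * (t + t') + (2 * lam) * s by ring]
  ring

lemma aux_C (lam θ : ℝ) (hlam : 0 < lam) (hθ : 0 < θ) (hne : lam ≠ θ)
    (t τ : ℝ) (h0 : 0 ≤ t) (h1 : 0 ≤ τ) :
    (∫ s in (0 : ℝ)..t, ∫ r in (0 : ℝ)..(t + τ),
      Real.exp (-lam * (t - s)) * Real.exp (-lam * (t + τ - r))
        * (1 / (2 * θ) * Real.exp (-θ * |s - r|))) =
    (1 / (2 * θ)) * ((1 / (lam + θ) - 1 / (lam - θ)) *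
        ((Real.exp (-lam * τ) - Real.exp (-lam * τ) * Real.exp (-(2 * lam) * t)) / (2 * lam))
      - 1 / (lam + θ) * ((Real.exp (-lam * τ) * Real.exp (-(lam + θ) * t)
          - Real.exp (-lam * τ) * Real.exp (-(2 * lam) * t)) / (lam - θ))
      + 1 / (lam - θ) * ((Real.exp (-θ * τ)
          - Real.exp (-θ * τ) * Real.exp (-(lam + θ) * t)) / (lam + θ))) := by
  have hp : lam + θ ≠ 0 := by positivity
  have h2 : 2 * lam ≠ 0 := by positivity
  have hm : lam - θ ≠ 0 := sub_ne_zero.mpr hne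
  have e : ∀ s ∈ Set.uIcc 0 t, _ := fun s hs => by
    rw [Set.uIcc_of_le h0] at hs
    exact aux_inner lam θ hlam hθ hne t (t + τ) s hs.1 (by linarith [hs.2])
  rw [intervalIntegral.integral_congr e, intervalIntegral.integral_const_mul,
    intervalIntegral.integral_add (Continuous.intervalIntegrable (by fun_prop) _ _)
    (Continuous.intervalIntegrable (by fun_prop) _ _),
    intervalIntegral.integral_sub (Continuous.intervalIntegrable (by fun_prop) _ _)
    (Continuous.intervalIntegrable (by fun_prop) _ _),
    intervalIntegral.integral_const_mul, intervalIntegral.integral_const_mul,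
    intervalIntegral.integral_const_mul,
    aux_int _ _ _ _ hp, aux_int _ _ _ _ hm, aux_int _ _ _ _ h2]
  simp only [← Real.exp_add]
  ring_nf

lemma aux_lim (lam θ : ℝ) (hlam : 0 < lam) (hθ : 0 < θ) (hne : lam ≠ θ)
    (τ : ℝ) (h1 : 0 ≤ τ) :
    Tendsto (fun t : ℝ => ∫ s in (0 : ℝ)..t, ∫ r in (0 : ℝ)..(t + τ),
      Real.exp (-lam * (t - s)) * Real.exp (-lam * (t + τ - r))
        * (1 / (2 * θ) * Real.exp (-θ * |s - r|))) atTop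
      (nhds ((lam * Real.exp (-θ * τ) - θ * Real.exp (-lam * τ)) / (lam - θ) *
        (1 / (2 * θ * lam * (lam + θ))))) := by
  have hp : lam + θ ≠ 0 := by positivity
  have hm : lam - θ ≠ 0 := sub_ne_zero.mpr hne
  have key : ∀ k : ℝ, 0 < k → Tendsto (fun t : ℝ => Real.exp (-k * t)) atTop (nhds 0) := by
    intro k hk
    apply Real.tendsto_exp_atBot.comp
    exact tendsto_id.const_mul_atTop_of_neg (by linarith)
  have k1 := key (2 * lam) (by positivity)
  have k2 := key (lam + θ) (by positivity)
  have T := ((((((k1.const_mul (Real.exp (-lam * τ))).const_sub (Real.exp (-lam * τ))).div_const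
    (2 * lam)).const_mul (1 / (lam + θ) - 1 / (lam - θ))).sub
    ((((k2.const_mul (Real.exp (-lam * τ))).sub (k1.const_mul (Real.exp (-lam * τ)))).div_const
      (lam - θ)).const_mul (1 / (lam + θ)))).add
    ((((k2.const_mul (Real.exp (-θ * τ))).const_sub (Real.exp (-θ * τ))).div_const
      (lam + θ)).const_mul (1 / (lam - θ)))).const_mul (1 / (2 * θ))
  refine Tendsto.congr' ?_ (T.trans (le_of_eq ?_))
  · filter_upwards [eventually_ge_atTop 0] with t ht
    exact (aux_C lam θ hlam hθ hne t τ ht h1).symm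
  · congr 1
    field_simp
    ring

/-- Asymptotically stationary autocorrelation of the linearly restoring
process driven by Ornstein–Uhlenbeck red noise:
`lim_{t→∞} C(t, t+τ)/C(t,t) = (λ e^{−θτ} − θ e^{−λτ})/(λ − θ)`, where
`C(t,t′) = ∫₀ᵗ∫₀^{t′} e^{−λ(t−s)} e^{−λ(t′−r)} (1/(2θ)) e^{−θ|s−r|} dr ds`;
the right-hand side is invariant under interchanging `λ` and `θ`. -/
theorem stmt_10 (lam θ : ℝ) (hlam : 0 < lam) (hθ : 0 < θ) (hne : lam ≠ θ)
    (C : ℝ → ℝ → ℝ)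
    (hC : ∀ t t' : ℝ, C t t' = ∫ s in (0 : ℝ)..t, ∫ r in (0 : ℝ)..t',
      Real.exp (-lam * (t - s)) * Real.exp (-lam * (t' - r))
        * (1 / (2 * θ) * Real.exp (-θ * |s - r|))) :
    ∀ τ : ℝ, 0 ≤ τ →
      Tendsto (fun t : ℝ => C t (t + τ) / C t t) atTop
        (nhds ((lam * Real.exp (-θ * τ) - θ * Real.exp (-lam * τ)) / (lam - θ))) ∧
      (lam * Real.exp (-θ * τ) - θ * Real.exp (-lam * τ)) / (lam - θ)
        = (θ * Real.exp (-lam * τ) - lam * Real.exp (-θ * τ)) / (θ - lam) := by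
  have hp : lam + θ ≠ 0 := by positivity
  have hm : lam - θ ≠ 0 := sub_ne_zero.mpr hne
  intro τ hτ
  refine ⟨?_, ?_⟩
  · have A := aux_lim lam θ hlam hθ hne τ hτ
    have B := aux_lim lam θ hlam hθ hne 0 le_rfl
    simp only [← hC] at A B
    have hD : (1 / (2 * θ * lam * (lam + θ))) ≠ 0 := by positivity
    simp only [add_zero, mul_zero, Real.exp_zero, mul_one, div_self hm, one_mul] at B
    have T := A.div B hD
    rwa [mul_div_assoc, div_self hD, mul_one] at T
  · rw [← neg_sub lam θ, ← neg_sub (lam * _), neg_div_neg_eq]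
end
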